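/- For every mean-zero q ∈ L²(R) on the x-periodic rectangle R = T × (0,H), ‖q‖²_{H⁻¹} ≤ (L²/(4π²))·‖∂_x q‖²_{H⁻¹} + (H²/π²)·‖∂_y q‖²_{H⁻¹}. -/

import Mathlib

open MeasureTheory Set

/-- The x-periodic rectangle `R = T × (0,H)`. -/
def RectR (L H : ℝ) : Set (ℝ × ℝ) := (Set.Ioo 0 L) ×ˢ (Set.Ioo 0 H)

/-- Test functions modeling `H¹₀(R)`: `C¹`, `L`-periodic in `x`, vanishing on
the top and bottom walls. -/
def AdmRect (L H : ℝ) (u : ℝ × ℝ → ℝ) : Prop :=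
  ContDiff ℝ 1 u ∧ (∀ x y, u (x + L, y) = u (x, y)) ∧
    (∀ x, u (x, 0) = 0) ∧ (∀ x, u (x, H) = 0)

/-- The squared energy (H¹ semi-)norm `‖∇u‖²_{L²(R)}`. -/
noncomputable def energyRect (L H : ℝ) (u : ℝ × ℝ → ℝ) : ℝ :=
  ∫ p in RectR L H, (fderiv ℝ u p (1, 0)) ^ 2 + (fderiv ℝ u p (0, 1)) ^ 2

lemma integral_sub_const_sq {L : ℝ} (c : ℝ) {g : ℝ → ℝ} (hg : Continuous g) :
    ∫ x in 0..L, (g x - c) ^ 2 =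
      (∫ x in 0..L, g x ^ 2) - 2 * c * (∫ x in 0..L, g x) + L * c ^ 2 := by
  have : ∀ x, (g x - c) ^ 2 = g x ^ 2 - 2 * c * g x + c ^ 2 := fun x => by ring
  simp_rw [this]
  rw [intervalIntegral.integral_add, intervalIntegral.integral_sub,
    intervalIntegral.integral_const_mul]
  · simp
  all_goals exact Continuous.intervalIntegrable (by fun_prop) _ _

/-- Dirichlet–Poincaré inequality with a constant below the optimal one: completing the square with
`T = -k tan (k (x - (a + b) / 2))`, a solution of a Riccati equation on `[a, b]`. -/
lemma mul_integral_sq_le_of_mul_lt_pi {a b k : ℝ} (hab : a ≤ b) (hk : 0 < k)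
    (hkb : k * (b - a) < Real.pi) {f f' : ℝ → ℝ} (hf : ∀ x, HasDerivAt f (f' x) x)
    (hf' : Continuous f') (ha : f a = 0) (hb : f b = 0) :
    k ^ 2 * ∫ x in a..b, f x ^ 2 ≤ ∫ x in a..b, f' x ^ 2 := by
  have hfc : Continuous f := continuous_iff_continuousAt.2 fun x => (hf x).continuousAt
  set T : ℝ → ℝ := fun x => -k * Real.tan (k * (x - (a + b) / 2))
  have hcos : ∀ x ∈ uIcc a b, Real.cos (k * (x - (a + b) / 2)) ≠ 0 := by
    intro x hx
    rw [uIcc_of_le hab] at hx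
    apply (Real.cos_pos_of_mem_Ioo ⟨?_, ?_⟩).ne' <;> nlinarith [hx.1, hx.2]
  have hTd : ∀ x ∈ uIcc a b, HasDerivAt T (-k ^ 2 - T x ^ 2) x := by
    intro x hx
    have h1 : HasDerivAt (fun x : ℝ => k * (x - (a + b) / 2)) (k * 1) x :=
      ((hasDerivAt_id x).sub_const _).const_mul k
    have h2 := ((Real.hasDerivAt_tan (hcos x hx)).comp x h1).const_mul (-k)
    convert! h2 using 1
    have hc := hcos x hx
    simp only [T, Real.tan_eq_sin_div_cos]
    set θ := k * (x - (a + b) / 2)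
    field_simp
    linear_combination -Real.sin_sq_add_cos_sq θ
  have hTc : ContinuousOn T (uIcc a b) := fun x hx => (hTd x hx).continuousAt.continuousWithinAt
  have hd : ∀ x ∈ uIcc a b, HasDerivAt (fun x => f x ^ 2 * T x)
      (2 * f x * f' x * T x + f x ^ 2 * (-k ^ 2 - T x ^ 2)) x := by
    intro x hx
    convert! ((hf x).pow 2).mul (hTd x hx) using 1
    simp
  have hi : IntervalIntegrable
      (fun x => 2 * f x * f' x * T x + f x ^ 2 * (-k ^ 2 - T x ^ 2)) volume a b :=
    ContinuousOn.intervalIntegrable (by fun_prop)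
  have hftc := intervalIntegral.integral_eq_sub_of_hasDerivAt hd hi
  simp only [ha, hb] at hftc
  have hnn : 0 ≤ ∫ x in a..b, (f' x - f x * T x) ^ 2 :=
    intervalIntegral.integral_nonneg hab fun x _ => sq_nonneg _
  have hint : ∫ x in a..b, (f' x - f x * T x) ^ 2 =
      (∫ x in a..b, f' x ^ 2) - k ^ 2 * (∫ x in a..b, f x ^ 2) -
        ∫ x in a..b, (2 * f x * f' x * T x + f x ^ 2 * (-k ^ 2 - T x ^ 2)) := by
    rw [← intervalIntegral.integral_const_mul, ← intervalIntegral.integral_sub,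
      ← intervalIntegral.integral_sub _ hi]
    · congr 1; ext x; ring
    all_goals exact Continuous.intervalIntegrable (by fun_prop) _ _
  linarith

/-- The **Poincaré inequality** on an interval, with the optimal constant, for functions vanishing at
both end points. -/
lemma integral_sq_le_of_eq_zero {a b : ℝ} (hab : a < b) {f f' : ℝ → ℝ}
    (hf : ∀ x, HasDerivAt f (f' x) x) (hf' : Continuous f') (ha : f a = 0) (hb : f b = 0) :
    ∫ x in a..b, f x ^ 2 ≤ ((b - a) / Real.pi) ^ 2 * ∫ x in a..b, f' x ^ 2 := by
  have hpos : 0 < Real.pi / (b - a) := div_pos Real.pi_pos (sub_pos.2 hab)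
  have key : (Real.pi / (b - a)) ^ 2 * ∫ x in a..b, f x ^ 2 ≤ ∫ x in a..b, f' x ^ 2 := by
    have hlim : Filter.Tendsto (fun k : ℝ => k ^ 2 * ∫ x in a..b, f x ^ 2)
        (nhdsWithin (Real.pi / (b - a)) (Iio (Real.pi / (b - a))))
        (nhds ((Real.pi / (b - a)) ^ 2 * ∫ x in a..b, f x ^ 2)) :=
      (Continuous.tendsto (by fun_prop) _).mono_left nhdsWithin_le_nhds
    refine le_of_tendsto hlim ?_
    filter_upwards [Ioo_mem_nhdsLT hpos] with k hk
    exact mul_integral_sq_le_of_mul_lt_pi hab.le hk.1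
      ((lt_div_iff₀ (sub_pos.2 hab)).1 hk.2) hf hf' ha hb
  have h := mul_le_mul_of_nonneg_left key (sq_nonneg ((b - a) / Real.pi))
  have hne : b - a ≠ 0 := (sub_pos.2 hab).ne'
  calc _ = ((b - a) / Real.pi) ^ 2 * ((Real.pi / (b - a)) ^ 2 * ∫ x in a..b, f x ^ 2) := by
        field_simp
    _ ≤ _ := h

/-- The **Wirtinger inequality** for periodic functions of zero mean. -/
lemma integral_sq_le_of_periodic {L : ℝ} (hL : 0 < L) {f f' : ℝ → ℝ}
    (hf : ∀ x, HasDerivAt f (f' x) x) (hf' : Continuous f') (hper : Function.Periodic f L)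
    (hmean : ∫ x in 0..L, f x = 0) :
    ∫ x in 0..L, f x ^ 2 ≤ (L / (2 * Real.pi)) ^ 2 * ∫ x in 0..L, f' x ^ 2 := by
  have hfc : Continuous f := continuous_iff_continuousAt.2 fun x => (hf x).continuousAt
  have hper' : Function.Periodic f' L := fun x => by
    have h1 := (hf (x + L)).comp_add_const x L
    rw [show (fun x => f (x + L)) = f from funext hper] at h1
    exact h1.unique (hf x)
  obtain ⟨c, hc⟩ : ∃ c, f c = f (c + L / 2) := by
    have h0 : f (L / 2 + L / 2) = f 0 := by
      rw [add_halves]; simpa using hper 0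
    have hcont : Continuous fun x => f x - f (x + L / 2) := by fun_prop
    have := mem_range_of_exists_le_of_exists_ge hcont (c := 0)
    rcases le_total (f 0) (f (L / 2)) with h | h
    · obtain ⟨c, hc⟩ := this ⟨0, by simpa only [zero_add, sub_nonneg, sub_nonpos] using h⟩ ⟨L / 2, by simpa only [h0, sub_nonneg, sub_nonpos] using h⟩
      exact ⟨c, sub_eq_zero.1 hc⟩
    · obtain ⟨c, hc⟩ := this ⟨L / 2, by simpa only [h0, sub_nonneg, sub_nonpos] using h⟩ ⟨0, by simpa only [zero_add, sub_nonneg, sub_nonpos] using h⟩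
      exact ⟨c, sub_eq_zero.1 hc⟩
  have hg : ∀ x, HasDerivAt (fun x => f x - f c) (f' x) x := fun x => (hf x).sub_const _
  have h1 := integral_sq_le_of_eq_zero (show c < c + L / 2 by linarith) hg hf' (sub_self _)
    (sub_eq_zero.2 hc.symm)
  have h2 := integral_sq_le_of_eq_zero (show c + L / 2 < c + L by linarith) hg hf'
    (sub_eq_zero.2 hc.symm) (sub_eq_zero.2 (hper c))
  have hsum := add_le_add h1 h2
  rw [show c + L / 2 - c = L / 2 by ring, show c + L - (c + L / 2) = L / 2 by ring, ← mul_add,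
    intervalIntegral.integral_add_adjacent_intervals
      (Continuous.intervalIntegrable (by fun_prop) _ _)
      (Continuous.intervalIntegrable (by fun_prop) _ _),
    intervalIntegral.integral_add_adjacent_intervals
      (Continuous.intervalIntegrable (by fun_prop) _ _)
      (Continuous.intervalIntegrable (by fun_prop) _ _)] at hsum
  have e1 : ∫ x in c..c + L, (f x - f c) ^ 2 = ∫ x in 0..L, (f x - f c) ^ 2 := by
    have hp : Function.Periodic (fun x => (f x - f c) ^ 2) L := fun x => by simp only [hper x]
    simpa using hp.intervalIntegral_add_eq c 0
  have e2 : ∫ x in c..c + L, f' x ^ 2 = ∫ x in 0..L, f' x ^ 2 := by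
    have hp : Function.Periodic (fun x => f' x ^ 2) L := fun x => by simp only [hper' x]
    simpa using hp.intervalIntegral_add_eq c 0
  rw [e1, e2, integral_sub_const_sq _ hfc, hmean] at hsum
  rw [show L / (2 * Real.pi) = L / 2 / Real.pi by field_simp]
  nlinarith [sq_nonneg (f c)]

/-- Convolution with the sawtooth kernel `L⁻¹ (s - L / 2)` inverts differentiation on periodic
functions of zero mean. -/
lemma hasDerivAt_sawtooth {L : ℝ} (hL : 0 < L) {g : ℝ → ℝ} (hg : Continuous g)
    (hper : Function.Periodic g L) (x : ℝ) :
    HasDerivAt (fun x => ∫ s in 0..L, L⁻¹ * (s - L / 2) * g (x + s))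
      (g x - L⁻¹ * ∫ s in 0..L, g s) x := by
  have hrep : (fun x => ∫ s in 0..L, L⁻¹ * (s - L / 2) * g (x + s)) = fun x =>
      L⁻¹ * (((∫ t in 0..x + L, t * g t) - ∫ t in 0..x, t * g t) -
        (x + L / 2) * ∫ s in 0..L, g s) := by
    ext x
    have h1 := intervalIntegral.integral_comp_add_left (a := 0) (b := L)
      (fun t => L⁻¹ * (t - x - L / 2) * g t) x
    simp only [add_sub_cancel_left, add_zero] at h1
    have h2 : ∀ t, L⁻¹ * (t - x - L / 2) * g t = L⁻¹ * (t * g t - (x + L / 2) * g t) :=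
      fun t => by ring
    have h3 : ∫ s in x..x + L, g s = ∫ s in 0..L, g s := by
      simpa using hper.intervalIntegral_add_eq x 0
    rw [h1]
    simp_rw [h2]
    rw [intervalIntegral.integral_const_mul, intervalIntegral.integral_sub,
      intervalIntegral.integral_const_mul, h3, intervalIntegral.integral_interval_sub_left]
    all_goals exact Continuous.intervalIntegrable (by fun_prop) _ _
  have hprim : ∀ z, HasDerivAt (fun z => ∫ t in 0..z, t * g t) (z * g z) z := fun z =>
    (show Continuous fun t => t * g t by fun_prop).integral_hasStrictDerivAt 0 z |>.hasDerivAt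
  rw [hrep]
  convert! (((hprim (x + L)).comp_add_const x L).sub (hprim x)).sub
    (((hasDerivAt_id x).add_const (L / 2)).mul_const (∫ s in 0..L, g s)) |>.const_mul L⁻¹ using 1
  rw [hper x]
  field_simp
  ring

lemma continuous_sawtooth (L : ℝ) {g : ℝ → ℝ} (hg : Continuous g) :
    Continuous fun x => ∫ s in 0..L, L⁻¹ * (s - L / 2) * g (x + s) :=
  intervalIntegral.continuous_parametric_intervalIntegral_of_continuous'
    (by simp only [Function.uncurry_def]; fun_prop) 0 L

lemma integral_sawtooth_eq_zero {L : ℝ} {g : ℝ → ℝ} (hg : Continuous g)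
    (hper : Function.Periodic g L) :
    ∫ x in 0..L, ∫ s in 0..L, L⁻¹ * (s - L / 2) * g (x + s) = 0 := by
  rw [intervalIntegral_intervalIntegral_swap]
  · have h : ∀ s, ∫ x in 0..L, L⁻¹ * (s - L / 2) * g (x + s) =
        (L⁻¹ * ∫ x in 0..L, g x) * (s - L / 2) := fun s => by
      rw [intervalIntegral.integral_const_mul, intervalIntegral.integral_comp_add_right,
        zero_add, add_comm L s, hper.intervalIntegral_add_eq s 0, zero_add]
      ring
    simp_rw [h]
    rw [intervalIntegral.integral_const_mul, intervalIntegral.integral_sub (by simp) (by simp)]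
    simp
    right; ring
  · refine (ContinuousOn.integrableOn_compact (isCompact_uIcc.prod isCompact_uIcc)
      (Continuous.continuousOn ?_)).mono_set (prod_mono uIoc_subset_uIcc uIoc_subset_uIcc)
    simp only [Function.uncurry_def]
    fun_prop

lemma integral_sawtooth_sq_le {L : ℝ} (hL : 0 < L) {g : ℝ → ℝ} (hg : Continuous g)
    (hper : Function.Periodic g L) :
    ∫ x in 0..L, (∫ s in 0..L, L⁻¹ * (s - L / 2) * g (x + s)) ^ 2 ≤
      (L / (2 * Real.pi)) ^ 2 *
        ((∫ x in 0..L, g x ^ 2) - L * (L⁻¹ * ∫ x in 0..L, g x) ^ 2) := by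
  refine (integral_sq_le_of_periodic hL (hasDerivAt_sawtooth hL hg hper) (by fun_prop)
    (fun x => by simp only [add_right_comm x L, hper _])
    (integral_sawtooth_eq_zero hg hper)).trans_eq ?_
  rw [integral_sub_const_sq _ hg]
  field_simp
  ring

lemma hasFDerivAt_integral_mul_comp_add {L : ℝ} {k : ℝ → ℝ} (hk : Continuous k) {u : ℝ × ℝ → ℝ}
    (hu : ContDiff ℝ 1 u) (p : ℝ × ℝ) :
    HasFDerivAt (fun p : ℝ × ℝ => ∫ s in 0..L, k s * u (p + (s, 0)))
      (∫ s in 0..L, k s • fderiv ℝ u (p + (s, 0))) p := by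
  have huc := hu.continuous
  have hud := hu.continuous_fderiv one_ne_zero
  have hF : Continuous fun z : (ℝ × ℝ) × ℝ => k z.2 • fderiv ℝ u (z.1 + (z.2, 0)) := by
    fun_prop
  obtain ⟨C, hC⟩ := ((isCompact_closedBall p 1).prod (isCompact_uIcc (a := 0) (b := L))
    ).exists_bound_of_continuousOn hF.continuousOn
  refine intervalIntegral.hasFDerivAt_integral_of_dominated_of_fderiv_le (bound := fun _ => C)
    (F' := fun p s => k s • fderiv ℝ u (p + (s, 0)))
    (Metric.closedBall_mem_nhds p one_pos) ?_ ?_ ?_ ?_ ?_ ?_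
  · exact Filter.Eventually.of_forall fun x => Continuous.aestronglyMeasurable (by fun_prop)
  · exact Continuous.intervalIntegrable (by fun_prop) _ _
  · exact Continuous.aestronglyMeasurable (by fun_prop)
  · exact Filter.Eventually.of_forall fun t ht x hx => hC (x, t) ⟨hx, uIoc_subset_uIcc ht⟩
  · simp
  · refine Filter.Eventually.of_forall fun t _ x _ => ?_
    have h := ((hu.differentiable one_ne_zero) (x + (t, 0))).hasFDerivAt
    exact ((hasFDerivAt_comp_add_right (t, 0)).2 h).const_mul (k t)

lemma contDiff_integral_mul_comp_add {L : ℝ} {k : ℝ → ℝ} (hk : Continuous k) {u : ℝ × ℝ → ℝ}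
    (hu : ContDiff ℝ 1 u) :
    ContDiff ℝ 1 (fun p : ℝ × ℝ => ∫ s in 0..L, k s * u (p + (s, 0))) := by
  have hud := hu.continuous_fderiv one_ne_zero
  refine contDiff_one_iff_hasFDerivAt.2
    ⟨_, ?_, hasFDerivAt_integral_mul_comp_add hk hu⟩
  apply intervalIntegral.continuous_parametric_intervalIntegral_of_continuous'
  simp only [Function.uncurry_def]
  fun_prop

lemma fderiv_integral_mul_comp_add_apply {L : ℝ} {k : ℝ → ℝ} (hk : Continuous k)
    {u : ℝ × ℝ → ℝ} (hu : ContDiff ℝ 1 u) (p v : ℝ × ℝ) :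
    fderiv ℝ (fun p : ℝ × ℝ => ∫ s in 0..L, k s * u (p + (s, 0))) p v =
      ∫ s in 0..L, k s * fderiv ℝ u (p + (s, 0)) v := by
  have hud := hu.continuous_fderiv one_ne_zero
  rw [(hasFDerivAt_integral_mul_comp_add hk hu p).fderiv,
    ContinuousLinearMap.intervalIntegral_apply (Continuous.intervalIntegrable (by fun_prop) _ _)]
  simp

lemma integrableOn_rectR {L H : ℝ} {f : ℝ × ℝ → ℝ} (hf : Continuous f) :
    IntegrableOn f (RectR L H) :=
  (hf.continuousOn.integrableOn_compact (isCompact_Icc.prod isCompact_Icc)).mono_set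
    (prod_mono Ioo_subset_Icc_self Ioo_subset_Icc_self)

lemma setIntegral_rectR {L H : ℝ} (hL : 0 < L) (hH : 0 < H) {f : ℝ × ℝ → ℝ}
    (hf : Continuous f) :
    ∫ p in RectR L H, f p = ∫ y in 0..H, ∫ x in 0..L, f (x, y) := by
  have hi : IntegrableOn f (RectR L H) := integrableOn_rectR hf
  simp only [intervalIntegral.integral_of_le hL.le, intervalIntegral.integral_of_le hH.le,
    integral_Ioc_eq_integral_Ioo]
  rw [RectR, Measure.volume_eq_prod, IntegrableOn, ← Measure.prod_restrict] at hi
  rw [RectR, Measure.volume_eq_prod, ← Measure.prod_restrict]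
  exact integral_prod_symm f hi

lemma integrableOn_mul_continuous_rectR {L H : ℝ} {q f : ℝ × ℝ → ℝ}
    (hq : IntegrableOn q (RectR L H)) (hf : Continuous f) :
    IntegrableOn (fun p => q p * f p) (RectR L H) := by
  obtain ⟨C, hC⟩ := ((isCompact_Icc (a := 0) (b := L)).prod
    (isCompact_Icc (a := 0) (b := H))).exists_bound_of_continuousOn hf.continuousOn
  refine Integrable.mul_bdd (c := C) hq hf.aestronglyMeasurable ?_
  refine (ae_restrict_iff' (measurableSet_Ioo.prod measurableSet_Ioo)).2
    (Filter.Eventually.of_forall fun p hp => hC p ?_)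
  exact prod_mono Ioo_subset_Icc_self Ioo_subset_Icc_self hp

/-- The mean of `u` over a period in the first variable. -/
noncomputable def xMean (L : ℝ) (u : ℝ × ℝ → ℝ) (y : ℝ) : ℝ := L⁻¹ * ∫ x in 0..L, u (x, y)

lemma continuous_xMean (L : ℝ) {u : ℝ × ℝ → ℝ} (hu : Continuous u) : Continuous (xMean L u) :=
  continuous_const.mul (intervalIntegral.continuous_parametric_intervalIntegral_of_continuous'
    (by simp only [Function.uncurry_def]; fun_prop) 0 L)

lemma hasDerivAt_xMean (L : ℝ) {u : ℝ × ℝ → ℝ} (hu : ContDiff ℝ 1 u) (y : ℝ) :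
    HasDerivAt (xMean L u) (xMean L (fun p => fderiv ℝ u p (0, 1)) y) y := by
  have h := (contDiff_integral_mul_comp_add (L := L) (k := fun _ => L⁻¹) continuous_const hu
    ).differentiable one_ne_zero (0, y) |>.hasFDerivAt
  have h' := h.comp_hasDerivAt y ((hasDerivAt_const y (0 : ℝ)).prodMk (hasDerivAt_id y))
  rw [fderiv_integral_mul_comp_add_apply continuous_const hu] at h'
  convert! h' using 1
  · ext z
    simp [xMean]
  · simp [xMean]

lemma AdmRect.periodic_fderiv {L H : ℝ} {u : ℝ × ℝ → ℝ} (hu : AdmRect L H u) (y : ℝ)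
    (v : ℝ × ℝ) : Function.Periodic (fun x => fderiv ℝ u (x, y) v) L := fun x => by
  have h := fderiv_comp_add_right (𝕜 := ℝ) (f := u) (x := (x, y)) (L, 0)
  have he : (fun p : ℝ × ℝ => u (p + (L, 0))) = u := by
    ext ⟨a, b⟩
    simpa using hu.2.1 a b
  rw [he] at h
  simp only [h, Prod.mk_add_mk, add_zero]

lemma hasDerivAt_fst {u : ℝ × ℝ → ℝ} (hu : Differentiable ℝ u) (x y : ℝ) :
    HasDerivAt (fun x => u (x, y)) (fderiv ℝ u (x, y) (1, 0)) x :=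
  (hu (x, y)).hasFDerivAt.comp_hasDerivAt x ((hasDerivAt_id x).prodMk (hasDerivAt_const x y))

lemma AdmRect.integral_fderiv_fst {L H : ℝ} {u : ℝ × ℝ → ℝ} (hu : AdmRect L H u) (y : ℝ) :
    ∫ x in 0..L, fderiv ℝ u (x, y) (1, 0) = 0 := by
  have hud := hu.1.continuous_fderiv one_ne_zero
  rw [intervalIntegral.integral_eq_sub_of_hasDerivAt
    (fun x _ => hasDerivAt_fst (hu.1.differentiable one_ne_zero) x y)
    (Continuous.intervalIntegrable (by fun_prop) _ _)]
  simpa [sub_eq_zero] using hu.2.1 0 y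

/-- The periodic primitive in the first variable of the mean-free part of `u`. -/
noncomputable def xPrimitive (L : ℝ) (u : ℝ × ℝ → ℝ) (p : ℝ × ℝ) : ℝ :=
  ∫ s in 0..L, L⁻¹ * (s - L / 2) * u (p + (s, 0))

lemma AdmRect.xPrimitive {L H : ℝ} {u : ℝ × ℝ → ℝ} (hu : AdmRect L H u) :
    AdmRect L H (xPrimitive L u) := by
  refine ⟨contDiff_integral_mul_comp_add (k := fun s => L⁻¹ * (s - L / 2)) (by fun_prop) hu.1,
    fun x y => ?_, fun x => ?_, fun x => ?_⟩
  · simp [_root_.xPrimitive, add_right_comm x L, hu.2.1]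
  · simp [_root_.xPrimitive, hu.2.2.1]
  · simp [_root_.xPrimitive, hu.2.2.2]

lemma fderiv_xPrimitive {L : ℝ} {u : ℝ × ℝ → ℝ} (hu : ContDiff ℝ 1 u) (x y : ℝ) (v : ℝ × ℝ) :
    fderiv ℝ (xPrimitive L u) (x, y) v =
      ∫ s in 0..L, L⁻¹ * (s - L / 2) * fderiv ℝ u (x + s, y) v := by
  have h := fderiv_integral_mul_comp_add_apply (L := L) (k := fun s => L⁻¹ * (s - L / 2))
    (by fun_prop) hu (x, y) v
  simp only [Prod.mk_add_mk, add_zero] at h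
  exact h

lemma AdmRect.fderiv_xPrimitive_fst {L H : ℝ} (hL : 0 < L) {u : ℝ × ℝ → ℝ}
    (hu : AdmRect L H u) (p : ℝ × ℝ) :
    fderiv ℝ (_root_.xPrimitive L u) p (1, 0) = u p - xMean L u p.2 := by
  obtain ⟨x, y⟩ := p
  have huc := hu.1.continuous
  have h1 := hasDerivAt_fst (hu.xPrimitive.1.differentiable one_ne_zero) x y
  have h2 := hasDerivAt_sawtooth hL (g := fun x => u (x, y)) (by fun_prop)
    (fun x => hu.2.1 x y) x
  refine h1.unique ?_
  convert! h2 using 1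
  ext z
  simp [_root_.xPrimitive]

lemma energyRect_eq {L H : ℝ} (hL : 0 < L) (hH : 0 < H) {u : ℝ × ℝ → ℝ}
    (hu : ContDiff ℝ 1 u) :
    energyRect L H u = ∫ y in 0..H, ((∫ x in 0..L, fderiv ℝ u (x, y) (1, 0) ^ 2) +
      ∫ x in 0..L, fderiv ℝ u (x, y) (0, 1) ^ 2) := by
  have hud := hu.continuous_fderiv one_ne_zero
  rw [energyRect, setIntegral_rectR hL hH (by fun_prop)]
  congr 1
  ext y
  exact intervalIntegral.integral_add (Continuous.intervalIntegrable (by fun_prop) _ _)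
    (Continuous.intervalIntegrable (by fun_prop) _ _)

lemma AdmRect.energyRect_xPrimitive_le {L H : ℝ} (hL : 0 < L) (hH : 0 < H) {u : ℝ × ℝ → ℝ}
    (hu : AdmRect L H u) :
    energyRect L H (_root_.xPrimitive L u) ≤ (L / (2 * Real.pi)) ^ 2 * (energyRect L H u -
      L * ∫ y in 0..H, xMean L (fun p => fderiv ℝ u p (0, 1)) y ^ 2) := by
  have hud := hu.1.continuous_fderiv one_ne_zero
  have hvd := hu.xPrimitive.1.continuous_fderiv one_ne_zero
  have hm := continuous_xMean L (u := fun p => fderiv ℝ u p (0, 1)) (by fun_prop)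
  have hcont : ∀ {w : ℝ × ℝ → ℝ}, ContDiff ℝ 1 w → Continuous fun y =>
      (∫ x in 0..L, fderiv ℝ w (x, y) (1, 0) ^ 2) + ∫ x in 0..L, fderiv ℝ w (x, y) (0, 1) ^ 2 := by
    intro w hw
    have hwd := hw.continuous_fderiv one_ne_zero
    apply Continuous.add <;>
    · apply intervalIntegral.continuous_parametric_intervalIntegral_of_continuous'
      simp only [Function.uncurry_def]
      fun_prop
  have hcu := hcont hu.1
  rw [energyRect_eq hL hH hu.1, energyRect_eq hL hH hu.xPrimitive.1,
    ← intervalIntegral.integral_const_mul, ← intervalIntegral.integral_sub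
      (hcu.intervalIntegrable _ _) (Continuous.intervalIntegrable (by fun_prop) _ _),
    ← intervalIntegral.integral_const_mul]
  refine intervalIntegral.integral_mono_on hH.le ((hcont hu.xPrimitive.1).intervalIntegrable _ _)
    (Continuous.intervalIntegrable (by fun_prop) _ _) fun y _ => ?_
  simp only [fderiv_xPrimitive hu.1]
  have h1 := integral_sawtooth_sq_le hL (g := fun x => fderiv ℝ u (x, y) (1, 0)) (by fun_prop)
    (hu.periodic_fderiv y _)
  have h2 := integral_sawtooth_sq_le hL (g := fun x => fderiv ℝ u (x, y) (0, 1)) (by fun_prop)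
    (hu.periodic_fderiv y _)
  rw [hu.integral_fderiv_fst] at h1
  rw [xMean]
  linarith

/-- A function of `y` alone, vanishing on the walls, whose derivative is `g` minus its mean. -/
lemma exists_admRect_of_continuous {L H : ℝ} (hL : 0 < L) (hH : 0 < H) {g : ℝ → ℝ}
    (hg : Continuous g) :
    ∃ w, AdmRect L H w ∧ (∃ c, ∀ p, fderiv ℝ w p (0, 1) = g p.2 - c) ∧
      energyRect L H w ≤ L * ∫ y in 0..H, g y ^ 2 := by
  set c := H⁻¹ * ∫ y in 0..H, g y with hc
  have hd : ∀ y, HasDerivAt (fun y => (∫ t in 0..y, g t) - c * y) (g y - c) y := fun y => by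
    convert! ((hg.integral_hasStrictDerivAt 0 y).hasDerivAt).sub
      ((hasDerivAt_id y).const_mul c) using 1
    ring
  set w : ℝ × ℝ → ℝ := fun p => (∫ t in 0..p.2, g t) - c * p.2 with hw
  have hfd : ∀ p : ℝ × ℝ, HasFDerivAt w ((g p.2 - c) • ContinuousLinearMap.snd ℝ ℝ ℝ) p :=
    fun p => (hd p.2).comp_hasFDerivAt p hasFDerivAt_snd
  have hw1 : ContDiff ℝ 1 w := contDiff_one_iff_hasFDerivAt.2 ⟨_, by fun_prop, hfd⟩
  refine ⟨w, ⟨hw1, fun _ _ => rfl, fun x => by simp [hw], fun x => ?_⟩, ⟨c, fun p => ?_⟩, ?_⟩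
  · simp only [hw, hc]
    field_simp
    ring
  · simp [(hfd p).fderiv]
  · rw [energyRect_eq hL hH hw1]
    simp only [(hfd _).fderiv, smul_apply, ContinuousLinearMap.coe_snd',
      smul_eq_mul, mul_zero, mul_one, intervalIntegral.integral_const, sub_zero]
    simp only [ne_eq, OfNat.ofNat_ne_zero, not_false_eq_true, zero_pow, mul_zero, zero_add]
    rw [intervalIntegral.integral_const_mul, integral_sub_const_sq _ hg]
    have hgc : ∫ y in 0..H, g y = H * c := by rw [hc]; field_simp
    rw [hgc]
    have : 0 ≤ H * c ^ 2 := by positivity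
    exact mul_le_mul_of_nonneg_left (by linarith) hL.le

lemma AdmRect.integral_xMean_sq_le {L H : ℝ} (hH : 0 < H) {u : ℝ × ℝ → ℝ}
    (hu : AdmRect L H u) :
    ∫ y in 0..H, xMean L u y ^ 2 ≤ (H / Real.pi) ^ 2 *
      ∫ y in 0..H, xMean L (fun p => fderiv ℝ u p (0, 1)) y ^ 2 := by
  have hud := hu.1.continuous_fderiv one_ne_zero
  simpa using integral_sq_le_of_eq_zero hH (hasDerivAt_xMean L hu.1)
    (continuous_xMean L (by fun_prop)) (by simp [xMean, hu.2.2.1]) (by simp [xMean, hu.2.2.2])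

lemma add_sq_le_of_sq_le_mul {A B α β x y : ℝ} (hα : 0 ≤ α) (hβ : 0 ≤ β) (hx : 0 ≤ x)
    (hy : 0 ≤ y) (hA : A ^ 2 ≤ α * x) (hB : B ^ 2 ≤ β * y) :
    (A + B) ^ 2 ≤ (α + β) * (x + y) := by
  have h1 : (2 * (A * B)) ^ 2 ≤ (α * y + β * x) ^ 2 := by
    have := mul_le_mul hA hB (sq_nonneg B) (by positivity)
    nlinarith [sq_nonneg (α * y - β * x)]
  have h2 := abs_le_of_sq_le_sq h1 (by positivity)
  nlinarith [le_abs_self (2 * (A * B))]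

lemma sq_le_of_abs_le_mul_sqrt {A N E F : ℝ} (hE : 0 ≤ E) (h : |A| ≤ N * Real.sqrt E)
    (hF : E ≤ F) : A ^ 2 ≤ N ^ 2 * F := by
  have h1 : A ^ 2 ≤ N ^ 2 * E := by
    calc A ^ 2 = |A| ^ 2 := (sq_abs A).symm
      _ ≤ (N * Real.sqrt E) ^ 2 := pow_le_pow_left₀ (abs_nonneg A) h 2
      _ = N ^ 2 * E := by rw [mul_pow, Real.sq_sqrt hE]
  exact h1.trans (mul_le_mul_of_nonneg_left hF (sq_nonneg N))

lemma energyRect_nonneg (L H : ℝ) (u : ℝ × ℝ → ℝ) : 0 ≤ energyRect L H u :=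
  integral_nonneg fun _ => by positivity

/-- Corollary 3.3: for every mean-zero `q ∈ L²(R)`,
`‖q‖₋₁² ≤ (L²/4π²)‖∂ₓq‖₋₁² + (H²/π²)‖∂_y q‖₋₁²`.  The dual norms on the right
are encoded by bounds `N₁, N₂` on the pairings `⟨∂ₓq,u⟩ = −∫ q ∂ₓu`,
`⟨∂_y q,u⟩ = −∫ q ∂_y u`; the conclusion expresses the bound on `‖q‖₋₁²` by
testing `⟨q, u⟩ = ∫ q u` against every `u ∈ H¹₀(R)`. -/
theorem dual_norm_rectangle (L H : ℝ) (hL : 0 < L) (hH : 0 < H)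
    (q : ℝ × ℝ → ℝ)
    (hq2 : MeasureTheory.IntegrableOn (fun p => (q p) ^ 2) (RectR L H))
    (hq1 : MeasureTheory.IntegrableOn q (RectR L H))
    (hmean : ∫ p in RectR L H, q p = 0)
    (N₁ N₂ : ℝ)
    (hN₁ : ∀ u : ℝ × ℝ → ℝ, AdmRect L H u →
      |∫ p in RectR L H, q p * (fderiv ℝ u p (1, 0))|
        ≤ N₁ * Real.sqrt (energyRect L H u))
    (hN₂ : ∀ u : ℝ × ℝ → ℝ, AdmRect L H u →
      |∫ p in RectR L H, q p * (fderiv ℝ u p (0, 1))|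
        ≤ N₂ * Real.sqrt (energyRect L H u)) :
    ∀ u : ℝ × ℝ → ℝ, AdmRect L H u →
      (∫ p in RectR L H, q p * u p) ^ 2
        ≤ ((L ^ 2 / (4 * Real.pi ^ 2)) * N₁ ^ 2 + (H ^ 2 / Real.pi ^ 2) * N₂ ^ 2) *
            energyRect L H u := by
  intro u hu
  have huc := hu.1.continuous
  have hm := continuous_xMean L huc
  obtain ⟨w, hw, ⟨c, hwc⟩, hwE⟩ := exists_admRect_of_continuous hL hH hm
  have hi1 : IntegrableOn (fun p => q p * (u p - xMean L u p.2)) (RectR L H) :=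
    integrableOn_mul_continuous_rectR hq1 (by fun_prop)
  have hi2 : IntegrableOn (fun p => q p * (xMean L u p.2 - c)) (RectR L H) :=
    integrableOn_mul_continuous_rectR hq1 (by fun_prop)
  have hsplit : ∫ p in RectR L H, q p * u p =
      (∫ p in RectR L H, q p * fderiv ℝ (xPrimitive L u) p (1, 0)) +
        ∫ p in RectR L H, q p * fderiv ℝ w p (0, 1) := by
    simp only [hu.fderiv_xPrimitive_fst hL, hwc]
    have hpt : ∀ p, q p * u p =
        q p * (u p - xMean L u p.2) + (q p * (xMean L u p.2 - c) + c * q p) := fun p => by ring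
    have hi3 : IntegrableOn (fun p => q p * (xMean L u p.2 - c) + c * q p) (RectR L H) :=
      hi2.add (hq1.const_mul c)
    simp_rw [hpt]
    rw [integral_add hi1 hi3, integral_add hi2 (hq1.const_mul c), integral_const_mul, hmean,
      mul_zero, add_zero]
  set D := L * ∫ y in 0..H, xMean L (fun p => fderiv ℝ u p (0, 1)) y ^ 2 with hD
  have hD0 : 0 ≤ D :=
    mul_nonneg hL.le (intervalIntegral.integral_nonneg hH.le fun _ _ => sq_nonneg _)
  have hvE := hu.energyRect_xPrimitive_le hL hH
  have hED : 0 ≤ energyRect L H u - D :=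
    nonneg_of_mul_nonneg_right ((energyRect_nonneg L H _).trans hvE)
      (by positivity)
  have hwE' : energyRect L H w ≤ (H / Real.pi) ^ 2 * D := by
    have := mul_le_mul_of_nonneg_left (hu.integral_xMean_sq_le hH) hL.le
    rw [hD]
    linarith
  have hA := sq_le_of_abs_le_mul_sqrt (energyRect_nonneg L H _) (hN₁ _ hu.xPrimitive) hvE
  have hB := sq_le_of_abs_le_mul_sqrt (energyRect_nonneg L H _) (hN₂ _ hw) hwE'
  rw [hsplit]
  have key := add_sq_le_of_sq_le_mul (α := N₁ ^ 2 * (L / (2 * Real.pi)) ^ 2)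
    (β := N₂ ^ 2 * (H / Real.pi) ^ 2) (by positivity) (by positivity) hED hD0
    (by rwa [mul_assoc]) (by rwa [mul_assoc])
  refine key.trans_eq ?_
  rw [sub_add_cancel]
  field_simp
  ring
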